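/- arXiv:1602.02429 — 5 statements merged into one kernel-verified Lean document; each statement's English description precedes it below -/
import Mathlib

section
/- There exists a Luzin family; that is, there exists an injective family (D_α)_{α<ω₁} indexed by the countable ordinals such that each D_α is an infinite subset of ℕ, D_α ∩ D_β is finite for all distinct α, β < ω₁, and for every α < ω₁ and every k ∈ ℕ the set {β < α : D_β ∩ D_α ⊆ {0, 1, …, k}} is finite. -/
open scoped Ordinal

/-- A Luzin family: an injective family `(D α)_{α < ω₁}` of infinite subsets of `ℕ`,
pairwise almost disjoint, such that for every `α < ω₁` and `k ∈ ℕ` the set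
`{β < α : D β ∩ D α ⊆ {0, …, k}}` is finite. -/
def IsLuzinFamily (D : {α : Ordinal // α < ω₁} → Set ℕ) : Prop :=
  Function.Injective D ∧
  (∀ α, (D α).Infinite) ∧
  (∀ α β, α ≠ β → (D α ∩ D β).Finite) ∧
  (∀ α : {α : Ordinal // α < ω₁}, ∀ k : ℕ,
    {β : {α : Ordinal // α < ω₁} | β < α ∧ D β ∩ D α ⊆ Set.Iic k}.Finite)

/-- Countably many pairwise almost disjoint infinite sets admit an infinite set almost disjoint from
all of them, whose intersections with them escape every bounded set up to finitely many indices. -/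
theorem exists_luzin_extension {ι : Type*} [Countable ι] [Infinite ι] (A : ι → Set ℕ)
    (hinf : ∀ i, (A i).Infinite) (had : Pairwise fun i j => (A i ∩ A j).Finite) :
    ∃ D : Set ℕ, D.Infinite ∧ (∀ i, (A i ∩ D).Finite) ∧
      ∀ k, {i | A i ∩ D ⊆ Set.Iic k}.Finite := by
  obtain ⟨_⟩ := nonempty_denumerable ι
  let e : ι ≃ ℕ := Denumerable.eqv ι
  have hd : ∀ n, ∃ d ∈ A (e.symm n), (∀ m < n, d ∉ A (e.symm m)) ∧ n < d := by
    intro n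
    have hfin : (⋃ m ∈ Set.Iio n, A (e.symm n) ∩ A (e.symm m)).Finite :=
      (Set.finite_Iio n).biUnion fun m hm => had (e.symm.injective.ne (ne_of_gt hm))
    obtain ⟨d, hdA, hd⟩ := ((hinf (e.symm n)).sdiff (hfin.union (Set.finite_Iic n))).nonempty
    simp only [Set.mem_union, Set.mem_iUnion, Set.mem_inter_iff, Set.mem_Iio, Set.mem_Iic,
      not_or, not_exists, not_le] at hd
    exact ⟨d, hdA, fun m hm h => hd.1 m hm ⟨hdA, h⟩, hd.2⟩
  choose d hdA hdn hlt using hd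
  refine ⟨Set.range d, ?_, fun i => ?_, fun k => ?_⟩
  · exact Set.infinite_of_forall_exists_gt fun n => ⟨d n, ⟨n, rfl⟩, hlt n⟩
  · refine ((Set.finite_Iic (e i)).image d).subset ?_
    rintro _ ⟨hi, n, rfl⟩
    refine ⟨n, not_lt.1 fun h => hdn n (e i) h ?_, rfl⟩
    simpa using hi
  · refine ((Set.finite_Iic k).image e.symm).subset fun i hi => ⟨e i, ?_, by simp⟩
    have h := hdA (e i)
    rw [Equiv.symm_apply_apply] at h
    exact (hlt (e i)).le.trans (hi ⟨h, e i, rfl⟩)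

/-- The family made of the columns of a pairing partition of `ℕ` followed by the sets `D β`. -/
def withColumns {β : Type*} (D : β → Set ℕ) : ℕ ⊕ β → Set ℕ :=
  Sum.elim (fun n => Set.range (Nat.pair n)) D

/-- A Luzin-type family exists along any well-order with countable initial segments. -/
theorem exists_luzin_of_countable_Iio {W : Type*} [LinearOrder W] [WellFoundedLT W]
    (hW : ∀ a : W, (Set.Iio a).Countable) :
    ∃ D : W → Set ℕ, (∀ a, (D a).Infinite) ∧ (Pairwise fun a b => (D a ∩ D b).Finite) ∧
      ∀ a k, {b | b < a ∧ D b ∩ D a ⊆ Set.Iic k}.Finite := by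
  have step (a : W) (f : Set.Iio a → Set ℕ) : ∃ S : Set ℕ,
      (∀ i, (withColumns f i).Infinite) →
      (Pairwise fun i j => (withColumns f i ∩ withColumns f j).Finite) →
      S.Infinite ∧ (∀ i, (withColumns f i ∩ S).Finite) ∧
        ∀ k, {i | withColumns f i ∩ S ⊆ Set.Iic k}.Finite := by
    have := (hW a).to_subtype
    by_cases h : (∀ i, (withColumns f i).Infinite) ∧
      Pairwise fun i j => (withColumns f i ∩ withColumns f j).Finite
    · obtain ⟨S, hS⟩ := exists_luzin_extension _ h.1 h.2
      exact ⟨S, fun _ _ => hS⟩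
    · exact ⟨∅, fun h₁ h₂ => absurd ⟨h₁, h₂⟩ h⟩
  choose G hG using step
  let D : W → Set ℕ := (wellFounded_lt (α := W)).fix fun a f => G a fun b => f b b.2
  have hD (a : W) : D a = G a fun b => D b := WellFounded.fix_eq _ _ a
  have key (a : W) : (D a).Infinite ∧
      (∀ i, (withColumns (fun b : Set.Iio a => D b) i ∩ D a).Finite) ∧
      ∀ k, {i | withColumns (fun b : Set.Iio a => D b) i ∩ D a ⊆ Set.Iic k}.Finite := by
    induction a using WellFoundedLT.induction with
    | ind a ih =>
      rw [hD a]
      apply hG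
      · rintro (n | b)
        · exact Set.infinite_range_of_injective fun x y h => (Nat.pair_eq_pair.1 h).2
        · exact (ih b b.2).1
      · rintro (m | b) (n | c) h
        · refine Set.finite_empty.subset ?_
          rintro _ ⟨⟨x, rfl⟩, y, hy⟩
          exact h (congrArg Sum.inl (Nat.pair_eq_pair.1 hy).1.symm)
        · exact (ih c c.2).2.1 (.inl m)
        · rw [Set.inter_comm]
          exact (ih b b.2).2.1 (.inl n)
        · rcases lt_or_gt_of_ne (fun hbc => h (congrArg Sum.inr hbc) : b ≠ c) with hbc | hbc
          · exact (ih c c.2).2.1 (.inr ⟨b, hbc⟩)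
          · rw [Set.inter_comm]
            exact (ih b b.2).2.1 (.inr ⟨c, hbc⟩)
  refine ⟨D, fun a => (key a).1, fun a b hab => ?_, fun a k => ?_⟩
  · rcases lt_or_gt_of_ne hab with h | h
    · exact (key b).2.1 (.inr ⟨a, h⟩)
    · rw [Set.inter_comm]
      exact (key a).2.1 (.inr ⟨b, h⟩)
  · refine ((((key a).2.2 k).preimage Sum.inr_injective.injOn).image Subtype.val).subset ?_
    rintro b ⟨hb, h⟩
    exact ⟨⟨b, hb⟩, h, rfl⟩

theorem exists_luzin_family :
    ∃ D : {α : Ordinal // α < ω₁} → Set ℕ, IsLuzinFamily D := by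
  have hW (a : {α : Ordinal // α < ω₁}) : (Set.Iio a).Countable := by
    have h : (Set.Iio a.1).Countable := by
      rw [← Cardinal.le_aleph0_iff_set_countable, Cardinal.mk_Iio_ordinal, Cardinal.lift_le_aleph0]
      exact Cardinal.lt_aleph_one_iff.1 (Cardinal.lt_ord.1 ((Cardinal.ord_aleph 1).symm ▸ a.2))
    exact h.preimage Subtype.val_injective
  obtain ⟨D, hinf, had, hfin⟩ := exists_luzin_of_countable_Iio hW
  refine ⟨D, fun a b hab => by_contra fun hne => hinf a ?_, hinf, fun a b h => had h, hfin⟩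
  simpa [hab] using had hne
end

section
/- Let (D_α)_{α<ω₁} be a Luzin family and let S, T ⊆ ω₁ be uncountable and disjoint. Then there is no set A ⊆ ℕ such that D_α \ A is finite for every α ∈ S and D_β ∩ A is finite for every β ∈ T. -/
open scoped Ordinal

/-- Every proper initial segment of `ω₁` is countable. -/
theorem countable_Iic_of_lt_omega_one (b : {α : Ordinal // α < ω₁}) : (Set.Iic b).Countable := by
  have h : (Set.Iic b.1).Countable := by
    rw [← Order.Iio_succ, ← Cardinal.le_aleph0_iff_set_countable, Cardinal.mk_Iio_ordinal,
      Cardinal.lift_le_aleph0, ← Order.lt_succ_iff, Cardinal.succ_aleph0, ← Cardinal.lt_ord,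
      Cardinal.ord_aleph]
    exact (Cardinal.isSuccLimit_omega 1).succ_lt b.2
  exact h.preimage Subtype.val_injective

/-- If every index in an uncountable set carries a finite set of naturals, then uncountably many
of these finite sets share an upper bound. -/
theorem exists_uncountable_subset_Iic {ι : Type*} {S : Set ι} (hS : ¬ S.Countable)
    (F : ι → Set ℕ) (hF : ∀ i ∈ S, (F i).Finite) :
    ∃ k : ℕ, ¬ {i ∈ S | F i ⊆ Set.Iic k}.Countable := by
  by_contra! h
  refine hS ((Set.countable_iUnion h).mono fun i hi => ?_)
  obtain ⟨k, hk⟩ := (hF i hi).bddAbove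
  exact Set.mem_iUnion.2 ⟨k, hi, fun n hn => hk hn⟩

theorem luzin_family_not_separated
    (D : {α : Ordinal // α < ω₁} → Set ℕ) (hD : IsLuzinFamily D)
    (S T : Set {α : Ordinal // α < ω₁})
    (hS : ¬ S.Countable) (hT : ¬ T.Countable) (hST : Disjoint S T) :
    ¬ ∃ A : Set ℕ, (∀ α ∈ S, (D α \ A).Finite) ∧ (∀ β ∈ T, (D β ∩ A).Finite) := by
  rintro ⟨A, hSA, hTA⟩
  obtain ⟨k, hk⟩ := exists_uncountable_subset_Iic hS _ hSA
  obtain ⟨m, hm⟩ := exists_uncountable_subset_Iic hT _ hTA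
  have hinf : {i ∈ S | D i \ A ⊆ Set.Iic k}.Infinite := fun h => hk h.countable
  let e := hinf.natEmbedding
  obtain ⟨t, ht, htB⟩ := Set.not_subset.1 fun h =>
    hm ((Set.countable_iUnion fun n => countable_Iic_of_lt_omega_one (e n).1).mono h)
  refine Set.infinite_range_of_injective (Subtype.val_injective.comp e.injective)
    ((hD.2.2.2 t (max k m)).subset ?_)
  rintro _ ⟨i, rfl⟩
  refine ⟨?_, ?_⟩
  · by_contra hbt
    exact htB (Set.mem_iUnion.2 ⟨i, not_lt.1 hbt⟩)
  · rintro n ⟨hnb, hnt⟩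
    by_cases hnA : n ∈ A
    · exact le_max_of_le_right (Set.mem_Iic.1 (ht.2 ⟨hnt, hnA⟩))
    · exact le_max_of_le_left (Set.mem_Iic.1 ((e i).2.2 ⟨hnb, hnA⟩))
end

section
/- Let A be a unital C*-algebra and let p, q ∈ A be projections. Then ‖p − q‖ = max(‖p(1 − q)‖, ‖(1 − p)q‖). -/
/-- In a unital C*-algebra, for projections `p` and `q`,
`‖p - q‖ = max ‖p(1 - q)‖ ‖(1 - p)q‖`. -/
theorem norm_sub_projections_eq_max
    {A : Type*} [NormedRing A] [StarRing A] [CStarRing A] [CompleteSpace A]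
    [NormedAlgebra ℂ A] [StarModule ℂ A]
    {p q : A}
    (hp_sa : IsSelfAdjoint p) (hp_idem : IsIdempotentElem p)
    (hq_sa : IsSelfAdjoint q) (hq_idem : IsIdempotentElem q) :
    ‖p - q‖ = max ‖p * (1 - q)‖ ‖(1 - p) * q‖ := by
  let _ : CStarAlgebra A := { }
  have hx : star (p * (1 - q)) = (1 - q) * p := by simp [hp_sa.star_eq, hq_sa.star_eq]
  have hy : star ((1 - p) * q) = q * (1 - p) := by simp [hp_sa.star_eq, hq_sa.star_eq]
  have hdecomp : (p - q) * (p - q) =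
      p * (1 - q) * star (p * (1 - q)) + (1 - p) * q * star ((1 - p) * q) := by
    have h₁ : p * (1 - q) * ((1 - q) * p) = p * (1 - q) * p := by
      rw [mul_assoc, ← mul_assoc (1 - q), hq_idem.one_sub.eq, mul_assoc]
    have h₂ : (1 - p) * q * (q * (1 - p)) = (1 - p) * q * (1 - p) := by
      rw [mul_assoc, ← mul_assoc q, hq_idem.eq, mul_assoc]
    rw [hx, hy, h₁, h₂]
    simp only [mul_sub, sub_mul, one_mul, mul_one, hp_idem.eq, hq_idem.eq]
    abel
  have horth : p * (1 - q) * star (p * (1 - q)) * ((1 - p) * q * star ((1 - p) * q)) = 0 := by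
    rw [hx, show p * (1 - q) * ((1 - q) * p) * ((1 - p) * q * star ((1 - p) * q)) =
      p * (1 - q) * (1 - q) * (p * (1 - p)) * q * star ((1 - p) * q) by simp only [mul_assoc],
      hp_idem.mul_one_sub_self]
    simp
  have hmax := IsSelfAdjoint.norm_add_eq_max (IsSelfAdjoint.mul_star_self (p * (1 - q)))
    (IsSelfAdjoint.mul_star_self ((1 - p) * q)) horth
  rw [← hdecomp, (hp_sa.sub hq_sa).norm_mul_self, CStarRing.norm_self_mul_star,
    CStarRing.norm_self_mul_star, ← sq, ← sq] at hmax
  refine (pow_left_inj₀ (norm_nonneg _) (by positivity) two_ne_zero).mp ?_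
  rw [hmax]
  exact ((pow_left_monotoneOn (n := 2)).map_max (norm_nonneg _) (norm_nonneg _)).symm
end

section
/- Let H be a separable infinite-dimensional complex Hilbert space. For every sequence (K_n)_{n∈ℕ} of compact operators on H and every ε with 0 < ε < 1/2, there exists a family (P_α)_{α<ω₁} of projections in B(H), each with infinite-dimensional range, such that: (i) P_α P_β is compact for all distinct α, β < ω₁; and (ii) for every β < ω₁ and every n ∈ ℕ, the set of ordinals α < β for which ‖(P_α + K_n)(P_β + K_n) − (P_β + K_n)(P_α + K_n)‖ < ε has at most n elements. -/
open scoped Ordinal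

section HilbertSpace

open scoped InnerProductSpace
open Filter Topology

variable {H : Type*} [NormedAddCommGroup H] [InnerProductSpace ℂ H]

theorem exists_orthonormal_nat_of_not_finiteDimensional (hH : ¬ FiniteDimensional ℂ H) :
    ∃ u : ℕ → H, Orthonormal ℂ u := by
  let b := Module.Basis.ofVectorSpace ℂ H
  have : Infinite (Module.Basis.ofVectorSpaceIndex ℂ H) := by
    by_contra h
    rw [not_infinite_iff_finite] at h
    exact hH (Module.Finite.of_basis b)
  let e := Infinite.natEmbedding (Module.Basis.ofVectorSpaceIndex ℂ H)
  exact ⟨_, InnerProductSpace.gramSchmidtNormed_orthonormal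
    (b.linearIndependent.comp e e.injective)⟩

theorem not_finiteDimensional_inf_orthogonal {M W : Submodule ℂ H} (hM : ¬ FiniteDimensional ℂ M)
    [FiniteDimensional ℂ W] : ¬ FiniteDimensional ℂ ↥(M ⊓ Wᗮ) := by
  intro h
  refine hM (Module.Finite.iff_fg.2 ?_)
  refine Submodule.fg_of_fg_map_of_fg_inf_ker (W.orthogonalProjectionOnto : H →ₗ[ℂ] W)
    (IsNoetherian.noetherian _) ?_
  have : LinearMap.ker (W.orthogonalProjectionOnto : H →ₗ[ℂ] W) = Wᗮ :=
    Submodule.ker_orthogonalProjectionOnto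
  rw [this]
  exact Module.Finite.iff_fg.1 h

theorem Orthonormal.tendsto_inner_zero {u : ℕ → H} (hu : Orthonormal ℂ u) (x : H) :
    Tendsto (fun n => ⟪u n, x⟫_ℂ) atTop (𝓝 0) := by
  have h := (hu.inner_products_summable x).tendsto_atTop_zero
  rw [tendsto_zero_iff_norm_tendsto_zero]
  have := (Real.continuous_sqrt.tendsto 0).comp h
  simpa [Function.comp_def, Real.sqrt_sq] using this

theorem IsCompactOperator.tendsto_zero_of_orthonormal [CompleteSpace H] {T : H →L[ℂ] H}
    (hT : IsCompactOperator T) {u : ℕ → H} (hu : Orthonormal ℂ u) :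
    Tendsto (fun n => T (u n)) atTop (𝓝 0) := by
  obtain ⟨C, hC, hCT⟩ := hT.image_closedBall_subset_compact (f := (T : H →ₗ[ℂ] H)) 1
  refine tendsto_of_subseq_tendsto fun ns hns => ?_
  obtain ⟨y, -, φ, hφ, hy⟩ := hC.tendsto_subseq (x := fun n => T (u (ns n))) fun n =>
    hCT ⟨u (ns n), by simp [hu.1], rfl⟩
  have hy0 : y = 0 := by
    have h1 : Tendsto (fun n => ⟪T (u (ns (φ n))), y⟫_ℂ) atTop (𝓝 ⟪y, y⟫_ℂ) :=
      hy.inner tendsto_const_nhds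
    have h2 : Tendsto (fun n => ⟪T (u (ns (φ n))), y⟫_ℂ) atTop (𝓝 0) := by
      simp_rw [← ContinuousLinearMap.adjoint_inner_right]
      exact (hu.tendsto_inner_zero _).comp (hns.comp hφ.tendsto_atTop)
    exact inner_self_eq_zero.1 (tendsto_nhds_unique h1 h2)
  exact ⟨φ, hy0 ▸ hy⟩

/-- A property that holds eventually along every orthonormal sequence of an infinite-dimensional
subspace holds at some unit vector orthogonal to a given finite-dimensional subspace. -/
theorem exists_unit_of_eventually {M W : Submodule ℂ H} (hM : ¬ FiniteDimensional ℂ M)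
    [FiniteDimensional ℂ W] {p : H → Prop}
    (hp : ∀ u : ℕ → H, Orthonormal ℂ u → (∀ n, u n ∈ M) → ∀ᶠ n in atTop, p (u n)) :
    ∃ w : H, ‖w‖ = 1 ∧ w ∈ Wᗮ ∧ p w := by
  obtain ⟨u, hu⟩ := exists_orthonormal_nat_of_not_finiteDimensional
    (not_finiteDimensional_inf_orthogonal (W := W) hM)
  have hu' : Orthonormal ℂ fun n => (u n : H) := hu.comp_linearIsometry (Submodule.subtypeₗᵢ _)
  obtain ⟨n, hn⟩ := (hp _ hu' fun n => (u n).2.1).exists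
  exact ⟨u n, hu'.1 n, (u n).2.2, hn⟩

/-- Step-by-step construction of an orthonormal sequence whose `k`-th term satisfies `p k`. -/
theorem exists_orthonormal_of_forall_exists {p : ℕ → H → Prop}
    (hp : ∀ (k : ℕ) (W : Submodule ℂ H), FiniteDimensional ℂ W →
      ∃ w : H, ‖w‖ = 1 ∧ w ∈ Wᗮ ∧ p k w) :
    ∃ w : ℕ → H, Orthonormal ℂ w ∧ ∀ k, p k (w k) := by
  classical
  have hp' (k : ℕ) (s : Finset H) : ∃ w : H, ‖w‖ = 1 ∧ (∀ x ∈ s, ⟪x, w⟫_ℂ = 0) ∧ p k w := by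
    obtain ⟨w, h1, h2, h3⟩ := hp k (Submodule.span ℂ s) inferInstance
    exact ⟨w, h1, fun x hx => h2 x (Submodule.subset_span hx), h3⟩
  choose g hg1 hg2 hg3 using hp'
  let L : ℕ → Finset H := fun k => Nat.rec ∅ (fun k s => insert (g k s) s) k
  have hL (m : ℕ) : g m (L m) ∈ L (m + 1) := Finset.mem_insert_self _ _
  have hmono : Monotone L := monotone_nat_of_le_succ fun k => Finset.subset_insert _ _
  have horth {m k : ℕ} (h : m < k) : ⟪g m (L m), g k (L k)⟫_ℂ = 0 := hg2 k _ _ (hmono h (hL m))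
  refine ⟨fun k => g k (L k), ⟨fun k => hg1 _ _, fun m k hmk => ?_⟩, fun k => hg3 _ _⟩
  rcases hmk.lt_or_gt with h | h
  · exact horth h
  · exact inner_eq_zero_symm.1 (horth h)

theorem mem_orthogonal_span_range {v : ℕ → H} {x : H} (hx : ∀ k, ⟪v k, x⟫_ℂ = 0) :
    x ∈ (Submodule.span ℂ (Set.range v)).topologicalClosureᗮ := by
  rw [Submodule.orthogonal_closure, Submodule.mem_orthogonal]
  intro y hy
  induction hy using Submodule.span_induction with
  | mem y hy => obtain ⟨k, rfl⟩ := hy; exact hx k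
  | zero => simp
  | add y z _ _ h1 h2 => simp [inner_add_left, h1, h2]
  | smul c y _ h => simp [inner_smul_left, h]

/-- If `P` fixes one of two orthogonal unit vectors `ξ`, `η` and almost kills the other, and
`Q` restricts on their span to the projection onto `ξ + η`, then the commutator of `P` and `Q` has norm at least almost
`1 / 2`, even after a perturbation by an operator `K` which is small at the vectors involved. -/
theorem norm_commutator_ge {P Q K : H →L[ℂ] H} (hP : ‖P‖ ≤ 1) (hQ : ‖Q‖ ≤ 1) {ξ η : H}
    (hξ : ‖ξ‖ = 1) (hη : ‖η‖ = 1) (hξη : ⟪ξ, η⟫_ℂ = 0) (hPξ : P ξ = ξ)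
    (hQadd : Q (ξ + η) = ξ + η) (hQsub : Q (ξ - η) = 0) {δ : ℝ} (hPη : ‖P η‖ ≤ δ)
    (hKξ : ‖K ξ‖ ≤ δ) (hKη : ‖K η‖ ≤ δ) (hKPη : ‖K (P η)‖ ≤ δ) :
    1 / 2 - 8 * δ ≤ ‖(P + K) * (Q + K) - (Q + K) * (P + K)‖ := by
  set C := (P + K) * (Q + K) - (Q + K) * (P + K) with hC
  have hadd : ‖ξ + η‖ = √2 := by
    rw [eq_comm, Real.sqrt_eq_iff_mul_self_eq (by norm_num) (norm_nonneg _),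
      norm_add_sq_eq_norm_sq_add_norm_sq_of_inner_eq_zero _ _ hξη, hξ, hη]
    norm_num
  have hsub : ‖ξ - η‖ = √2 := by
    rw [sub_eq_add_neg, eq_comm, Real.sqrt_eq_iff_mul_self_eq (by norm_num) (norm_nonneg _),
      norm_add_sq_eq_norm_sq_add_norm_sq_of_inner_eq_zero _ _ (by simp [hξη] : ⟪ξ, -η⟫_ℂ = 0),
      norm_neg, hξ, hη]
    norm_num
  have hQξ : Q ξ = (1 / 2 : ℂ) • (ξ + η) := by
    have : ξ = (1 / 2 : ℂ) • (ξ + η) + (1 / 2 : ℂ) • (ξ - η) := by module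
    conv_lhs => rw [this]
    rw [map_add, map_smul, map_smul, hQadd, hQsub, smul_zero, add_zero]
  have hval : C (ξ + η) = (1 / 2 : ℂ) • (ξ - η) + (P η - Q (P η) + K η + P (K ξ) + P (K η)
      - K (P η) - Q (K ξ) - Q (K η)) := by
    have h1 : C (ξ + η) = P (Q (ξ + η)) + P (K (ξ + η)) + K (Q (ξ + η)) + K (K (ξ + η))
        - (Q (P (ξ + η)) + Q (K (ξ + η)) + K (P (ξ + η)) + K (K (ξ + η))) := by
      simp only [hC, sub_apply, mul_apply_eq_comp, add_apply, map_add]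
      abel
    rw [h1, hQadd]
    simp only [map_add, hPξ, hQξ]
    module
  have hbd {A : H →L[ℂ] H} (hA : ‖A‖ ≤ 1) {x : H} (hx : ‖x‖ ≤ δ) : ‖A x‖ ≤ δ :=
    (A.le_of_opNorm_le hA x).trans (by simpa using hx)
  have herr : ‖P η - Q (P η) + K η + P (K ξ) + P (K η) - K (P η) - Q (K ξ) - Q (K η)‖
      ≤ 8 * δ := by
    refine (norm_sub_le _ _).trans ?_
    have := hbd hQ hKη
    have := hbd hQ hKξ
    have := hbd hP hKη
    have := hbd hP hKξ
    have := hbd hQ hPη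
    have a1 := norm_sub_le (P η) (Q (P η))
    have a2 := norm_add_le (P η - Q (P η)) (K η)
    have a3 := norm_add_le (P η - Q (P η) + K η) (P (K ξ))
    have a4 := norm_add_le (P η - Q (P η) + K η + P (K ξ)) (P (K η))
    have a5 := norm_sub_le (P η - Q (P η) + K η + P (K ξ) + P (K η)) (K (P η))
    have a6 := norm_sub_le (P η - Q (P η) + K η + P (K ξ) + P (K η) - K (P η)) (Q (K ξ))
    linarith
  have hlow : √2 / 2 - 8 * δ ≤ ‖C (ξ + η)‖ := by
    have := norm_sub_le_norm_add ((1 / 2 : ℂ) • (ξ - η)) (P η - Q (P η) + K η + P (K ξ) + P (K η)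
      - K (P η) - Q (K ξ) - Q (K η))
    rw [← hval, norm_smul, hsub, show ‖(1 / 2 : ℂ)‖ = 1 / 2 by norm_num] at this
    linarith
  have hup := C.le_opNorm (ξ + η)
  rw [hadd] at hup
  have h2 : 1 ≤ √2 := Real.one_le_sqrt.2 (by norm_num)
  have hδ : 0 ≤ δ := (norm_nonneg _).trans hPη
  by_contra! hlt
  nlinarith [mul_lt_mul_of_pos_right hlt (by linarith : 0 < √2)]

theorem Orthonormal.pair_sum {w : ℕ → H} (hw : Orthonormal ℂ w) :
    Orthonormal ℂ fun j => ((√2 : ℝ)⁻¹ : ℂ) • (w (2 * j) + w (2 * j + 1)) := by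
  rw [orthonormal_iff_ite] at hw ⊢
  intro i j
  have h1 : ¬ 2 * i = 2 * j + 1 := by omega
  have h2 : ¬ 2 * i + 1 = 2 * j := by omega
  have h3 : ((√2 : ℝ) : ℂ) * (√2 : ℝ) = 2 := by
    rw [← Complex.ofReal_mul, Real.mul_self_sqrt (by norm_num)]
    norm_num
  have h4 : ((√2 : ℝ) : ℂ)⁻¹ * ((√2 : ℝ) : ℂ)⁻¹ = 2⁻¹ := by rw [← mul_inv, h3]
  simp only [inner_smul_left, inner_smul_right, inner_add_left, inner_add_right, hw, h1, h2,
    map_inv₀, Complex.conj_ofReal, if_false, add_zero, zero_add, Nat.add_right_cancel_iff]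
  by_cases h : i = j
  · subst h
    simp only [if_true, ← two_mul, mul_one]
    rw [mul_left_comm, h4]
    norm_num
  · simp [h]

theorem isCompactOperator_rankOne (a b : H) :
    IsCompactOperator (InnerProductSpace.rankOne ℂ a b : H →L[ℂ] H) := by
  rw [InnerProductSpace.rankOne_def']
  exact (isCompactOperator_of_locallyCompactSpace_dom (innerSL ℂ b)).clm_comp
    (ContinuousLinearMap.toSpanSingleton ℂ a)

variable [CompleteSpace H]

theorem isCompactOperator_tsum {ι : Type*} {F : ι → H →L[ℂ] H}
    (hF : ∀ k, IsCompactOperator (F k)) :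
    IsCompactOperator (∑' k, F k : H →L[ℂ] H) := by
  by_cases h : Summable F
  · refine isCompactOperator_of_tendsto h.hasSum (Eventually.of_forall fun s => ?_)
    have hs : ∑ k ∈ s, F k ∈ compactOperator (RingHom.id ℂ) H H := sum_mem fun k _ => hF k
    exact hs
  · rw [tsum_eq_zero_of_not_summable h]
    exact isCompactOperator_zero

/-- The orthogonal projection onto the closed linear span of a sequence. -/
noncomputable def spanProjection (v : ℕ → H) : H →L[ℂ] H :=
  (Submodule.span ℂ (Set.range v)).topologicalClosure.starProjection

theorem isStarProjection_spanProjection (v : ℕ → H) : IsStarProjection (spanProjection v) :=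
  isStarProjection_starProjection

theorem spanProjection_apply_self (v : ℕ → H) (k : ℕ) : spanProjection v (v k) = v k :=
  Submodule.starProjection_eq_self_iff.2
    (Submodule.le_topologicalClosure _ (Submodule.subset_span ⟨k, rfl⟩))

theorem spanProjection_apply_eq_zero {v : ℕ → H} {x : H} (hx : ∀ k, ⟪v k, x⟫_ℂ = 0) :
    spanProjection v x = 0 :=
  (Submodule.starProjection_apply_eq_zero_iff _).2 (mem_orthogonal_span_range hx)

theorem not_finiteDimensional_range_spanProjection {v : ℕ → H} (hv : Orthonormal ℂ v) :
    ¬ FiniteDimensional ℂ (LinearMap.range (spanProjection v : H →ₗ[ℂ] H)) := by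
  intro h
  have hli : LinearIndependent ℂ fun k =>
      (⟨v k, v k, spanProjection_apply_self v k⟩ :
        LinearMap.range (spanProjection v : H →ₗ[ℂ] H)) :=
    LinearIndependent.of_comp (Submodule.subtype _) hv.linearIndependent
  have := hli.finite
  exact not_finite ℕ

/-- If `S` agrees with `T` on the vectors `v k` and vanishes on their orthogonal complement, then
`S` is `T` composed with the projection onto the closed span of `v`. -/
theorem mul_spanProjection_eq {v : ℕ → H} {T S : H →L[ℂ] H} (h : ∀ k, T (v k) = S (v k))
    (hS : ∀ x, (∀ k, ⟪v k, x⟫_ℂ = 0) → S x = 0) : T * spanProjection v = S := by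
  ext x
  set y := spanProjection v x
  have hmem : y ∈ (Submodule.span ℂ (Set.range v)).topologicalClosure :=
    Submodule.starProjection_apply_mem _ _
  have h1 : T y = S y := by
    refine ContinuousLinearMap.eqOn_closure_span (s := Set.range v) ?_ hmem
    rintro _ ⟨k, rfl⟩
    exact h k
  have h2 : S (x - y) = 0 := hS _ fun k =>
    Submodule.sub_starProjection_mem_orthogonal x _
      (Submodule.le_topologicalClosure _ (Submodule.subset_span ⟨k, rfl⟩))
  rw [map_sub, sub_eq_zero] at h2
  rw [h2, ← h1]
  rfl

theorem isCompactOperator_mul_spanProjection {v : ℕ → H} (hv : Orthonormal ℂ v)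
    {T : H →L[ℂ] H} (hTsa : IsSelfAdjoint T) (hT : Summable fun k => ‖T (v k)‖) :
    IsCompactOperator (T * spanProjection v : H →L[ℂ] H) ∧
      IsCompactOperator (spanProjection v * T : H →L[ℂ] H) := by
  have hsum : Summable fun k => InnerProductSpace.rankOne ℂ (T (v k)) (v k) :=
    Summable.of_norm (by simpa [hv.1] using hT)
  have happ (x : H) : (∑' k, InnerProductSpace.rankOne ℂ (T (v k)) (v k)) x =
      ∑' k, ⟪v k, x⟫_ℂ • T (v k) := by
    simpa using (ContinuousLinearMap.apply ℂ H x).map_tsum hsum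
  have heq : T * spanProjection v = ∑' k, InnerProductSpace.rankOne ℂ (T (v k)) (v k) := by
    refine mul_spanProjection_eq (fun j => ?_) fun x hx => ?_
    · rw [happ, tsum_eq_single j fun k hk => by rw [hv.2 hk, zero_smul]]
      simp [hv.1]
    · simp [happ, hx]
  refine ⟨heq ▸ isCompactOperator_tsum fun k => isCompactOperator_rankOne _ _, ?_⟩
  have hstar : spanProjection v * T = ∑' k, InnerProductSpace.rankOne ℂ (v k) (T (v k)) := by
    have := congrArg star heq
    rw [star_mul, hTsa.star_eq, (isStarProjection_spanProjection v).isSelfAdjoint.star_eq,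
      tsum_star] at this
    simpa [ContinuousLinearMap.star_eq_adjoint] using this
  exact hstar ▸ isCompactOperator_tsum fun k => isCompactOperator_rankOne _ _

/-- A projection of infinite rank. -/
structure IsInfiniteProjection (P : H →L[ℂ] H) : Prop where
  isStarProjection : IsStarProjection P
  not_finiteDimensional : ¬ FiniteDimensional ℂ (LinearMap.range (P : H →ₗ[ℂ] H))

theorem isInfiniteProjection_spanProjection {v : ℕ → H} (hv : Orthonormal ℂ v) :
    IsInfiniteProjection (spanProjection v) :=
  ⟨isStarProjection_spanProjection v, not_finiteDimensional_range_spanProjection hv⟩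

theorem exists_pairwise_mul_eq_zero (hH : ¬ FiniteDimensional ℂ H) :
    ∃ R : ℕ → H →L[ℂ] H, (∀ n, IsInfiniteProjection (R n)) ∧ ∀ m n, m ≠ n → R m * R n = 0 := by
  obtain ⟨u, hu⟩ := exists_orthonormal_nat_of_not_finiteDimensional hH
  have hpair (n : ℕ) : Function.Injective (Nat.pair n) := fun a b h => (Nat.pair_eq_pair.1 h).2
  refine ⟨fun n => spanProjection fun m => u (Nat.pair n m),
    fun n => isInfiniteProjection_spanProjection (hu.comp _ (hpair n)), fun m n hmn => ?_⟩
  refine mul_spanProjection_eq (fun k => ?_) fun _ _ => rfl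
  exact spanProjection_apply_eq_zero fun j => hu.2 fun h => hmn (Nat.pair_eq_pair.1 h).1

/-- Given projections that are almost orthogonal and compact operators, we can pick an orthonormal
sequence running through prescribed ranges on which all other projections and all the compact
operators are as small as we wish. -/
theorem exists_orthonormal_mem_range {P K : ℕ → H →L[ℂ] H}
    (hP : ∀ j, IsInfiniteProjection (P j))
    (hPP : ∀ i j, i ≠ j → IsCompactOperator (P i * P j : H →L[ℂ] H))
    (hK : ∀ n, IsCompactOperator (K n)) (s : ℕ → ℕ) {δ : ℕ → ℝ} (hδ : ∀ k, 0 < δ k) :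
    ∃ w : ℕ → H, Orthonormal ℂ w ∧ ∀ k, P (s k) (w k) = w k ∧
      (∀ i < s k, ‖P i (w k)‖ ≤ δ k) ∧ (∀ n ≤ k, ‖K n (w k)‖ ≤ δ k) ∧
      ∀ n ≤ k, ∀ i < s k, ‖K n (P i (w k))‖ ≤ δ k := by
  refine exists_orthonormal_of_forall_exists (p := fun k w => P (s k) w = w ∧
    (∀ i < s k, ‖P i w‖ ≤ δ k) ∧ (∀ n ≤ k, ‖K n w‖ ≤ δ k) ∧
      ∀ n ≤ k, ∀ i < s k, ‖K n (P i w)‖ ≤ δ k) fun k W hW => ?_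
  refine exists_unit_of_eventually (hP (s k)).not_finiteDimensional fun u hu huM => ?_
  have hfix (n : ℕ) : P (s k) (u n) = u n := by
    obtain ⟨y, hy⟩ := huM n
    rw [← hy]
    exact congrArg (· y) (hP (s k)).isStarProjection.isIdempotentElem.eq
  have hsmall {T : H →L[ℂ] H} (hT : IsCompactOperator T) : ∀ᶠ n in atTop, ‖T (u n)‖ ≤ δ k := by
    have := (hT.tendsto_zero_of_orthonormal hu).norm
    rw [norm_zero] at this
    exact this.eventually_le_const (hδ k)
  have h1 : ∀ᶠ n in atTop, ∀ i < s k, ‖P i (u n)‖ ≤ δ k := by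
    refine (Set.finite_lt_nat _).eventually_all.2 fun i hi => ?_
    filter_upwards [hsmall (hPP i (s k) hi.ne)] with n hn
    simpa [hfix] using hn
  have h2 : ∀ᶠ n in atTop, ∀ m ≤ k, ‖K m (u n)‖ ≤ δ k :=
    (Set.finite_le_nat _).eventually_all.2 fun m _ => hsmall (hK m)
  have h3 : ∀ᶠ n in atTop, ∀ m ≤ k, ∀ i < s k, ‖K m (P i (u n))‖ ≤ δ k :=
    (Set.finite_le_nat _).eventually_all.2 fun m _ =>
      (Set.finite_lt_nat _).eventually_all.2 fun i _ =>
        hsmall (T := K m * P i) ((hK m).comp_clm (P i))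
  filter_upwards [h1, h2, h3] with n h1 h2 h3
  exact ⟨hfix n, h1, h2, h3⟩

/-- The step of the transfinite construction: a sequence of almost orthogonal projections of
infinite rank can be extended by one more projection, whose perturbed commutators with the given
ones are large. -/
theorem exists_almost_orthogonal_projection {P K : ℕ → H →L[ℂ] H}
    (hP : ∀ j, IsInfiniteProjection (P j))
    (hPP : ∀ i j, i ≠ j → IsCompactOperator (P i * P j : H →L[ℂ] H))
    (hK : ∀ n, IsCompactOperator (K n)) {ε : ℝ} (hε : ε < 1 / 2) :
    ∃ Q : H →L[ℂ] H, IsInfiniteProjection Q ∧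
      (∀ j, IsCompactOperator (P j * Q : H →L[ℂ] H) ∧ IsCompactOperator (Q * P j : H →L[ℂ] H)) ∧
      ∀ j, ∀ n ≤ j, ε ≤ ‖(P j + K n) * (Q + K n) - (Q + K n) * (P j + K n)‖ := by
  set c := (1 / 2 - ε) / 8 with hc
  have hc0 : 0 < c := by linarith
  obtain ⟨w, hw, hw'⟩ := exists_orthonormal_mem_range hP hPP hK (fun k => (k + 1) / 2)
    (δ := fun k => c * (1 / 2) ^ k) fun k => by positivity
  set v : ℕ → H := fun j => ((√2 : ℝ)⁻¹ : ℂ) • (w (2 * j) + w (2 * j + 1)) with hv_def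
  have hv : Orthonormal ℂ v := hw.pair_sum
  have hδ (k : ℕ) : c * (1 / 2) ^ k ≤ c :=
    mul_le_of_le_one_right hc0.le (pow_le_one₀ (by norm_num) (by norm_num))
  have hsum (i : ℕ) : Summable fun k => ‖P i (v k)‖ := by
    refine Summable.of_norm_bounded_eventually_nat (g := fun k => 2 * c * (1 / 2) ^ k)
      (summable_geometric_two.mul_left _) ?_
    filter_upwards [eventually_gt_atTop i] with k hk
    have h1 := (hw' (2 * k)).2.1 i (by omega)
    have h2 := (hw' (2 * k + 1)).2.1 i (by omega)
    have hpow {m : ℕ} (hm : k ≤ m) : c * (1 / 2 : ℝ) ^ m ≤ c * (1 / 2) ^ k :=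
      mul_le_mul_of_nonneg_left (pow_le_pow_of_le_one (by norm_num) (by norm_num) hm) hc0.le
    have h3 := hpow (by omega : k ≤ 2 * k)
    have h4 := hpow (by omega : k ≤ 2 * k + 1)
    have h5 : ‖((√2 : ℝ)⁻¹ : ℂ)‖ ≤ 1 := by
      rw [norm_inv, Complex.norm_real, Real.norm_of_nonneg (Real.sqrt_nonneg _)]
      exact inv_le_one_of_one_le₀ (Real.one_le_sqrt.2 (by norm_num))
    rw [norm_norm, hv_def, map_smul, norm_smul, map_add]
    calc _ ≤ 1 * ‖P i (w (2 * k)) + P i (w (2 * k + 1))‖ := by gcongr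
      _ ≤ ‖P i (w (2 * k))‖ + ‖P i (w (2 * k + 1))‖ := by rw [one_mul]; exact norm_add_le _ _
      _ ≤ _ := by linarith
  refine ⟨spanProjection v, isInfiniteProjection_spanProjection hv, fun j =>
    isCompactOperator_mul_spanProjection hv (hP j).isStarProjection.isSelfAdjoint (hsum j),
    fun j n hn => ?_⟩
  obtain ⟨hξP, -, hξK, -⟩ := hw' (2 * j)
  obtain ⟨-, hηP, hηK, hηKP⟩ := hw' (2 * j + 1)
  have hj : (2 * j + 1) / 2 = j := by omega
  rw [hj] at hξP
  have hadd : w (2 * j) + w (2 * j + 1) = (√2 : ℂ) • v j := by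
    rw [hv_def, smul_smul, mul_inv_cancel₀ (by simp), one_smul]
  have hsub (k : ℕ) : ⟪v k, w (2 * j) - w (2 * j + 1)⟫_ℂ = 0 := by
    have h1 : ¬ 2 * k = 2 * j + 1 := by omega
    have h2 : ¬ 2 * k + 1 = 2 * j := by omega
    simp [hv_def, orthonormal_iff_ite.1 hw, h1, h2]
  have := norm_commutator_ge (P := P j) (Q := spanProjection v) (K := K n)
    (IsStarProjection.norm_le _ (hP j).isStarProjection)
    (IsStarProjection.norm_le _ (isStarProjection_spanProjection v))
    (hw.1 (2 * j)) (hw.1 (2 * j + 1)) (hw.2 (by omega)) hξP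
    (by rw [hadd, map_smul, spanProjection_apply_self]) (spanProjection_apply_eq_zero hsub)
    ((hηP j (by omega)).trans (hδ _)) ((hξK n (by omega)).trans (hδ _))
    ((hηK n (by omega)).trans (hδ _)) ((hηKP n (by omega) j (by omega)).trans (hδ _))
  linarith

end HilbertSpace

theorem Ordinal.countable_Iio_of_lt_omega_one (β : {α : Ordinal // α < ω₁}) :
    Countable (Set.Iio β) := by
  have h : Countable (Set.Iio (β : Ordinal)) := by
    rw [← Cardinal.mk_le_aleph0_iff, Cardinal.mk_Iio_ordinal, Cardinal.lift_le_aleph0,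
      ← Cardinal.lt_aleph_one_iff]
    exact Cardinal.lt_omega_iff_card_lt.1 β.2
  let f : Set.Iio β → Set.Iio (β : Ordinal) := fun α => ⟨α.1.1, α.2⟩
  have hf : Function.Injective f := fun a b hab =>
    Subtype.ext (Subtype.ext (congrArg (fun x => x.1) hab))
  exact hf.countable

/-- Transfinite recursion along a well-order with countable initial segments. Starting from a
sequence `R` of good, pairwise `r`-related elements, a step that extends sequences of such elements
yields a good, pairwise `r`-related family along the well-order. -/
theorem exists_family_of_sequence_extension {I X : Type*} [LinearOrder I] [WellFoundedLT I]
    (hI : ∀ β : I, Countable (Set.Iio β)) {good : X → Prop} {r : X → X → Prop}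
    {R : ℕ → X} (hR : ∀ n, good (R n)) (hRr : ∀ m n, m ≠ n → r (R m) (R n))
    {c : ℕ → X → X → Prop}
    (hext : ∀ p : ℕ → X, (∀ j, good (p j)) → (∀ i j, i ≠ j → r (p i) (p j)) →
      ∃ q, good q ∧ (∀ j, r (p j) q ∧ r q (p j)) ∧ ∀ j, ∀ n ≤ j, c n (p j) q) :
    ∃ P : I → X, (∀ α, good (P α)) ∧ (∀ α β, α ≠ β → r (P α) (P β)) ∧
      ∀ β, ∀ n : ℕ, ∃ F : Finset I, F.card ≤ n ∧ {α | α < β ∧ ¬ c n (P α) (P β)} ⊆ ↑F := by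
  classical
  have e (β : I) : Nonempty (ℕ ≃ ℕ ⊕ Set.Iio β) := by
    obtain ⟨h⟩ := nonempty_denumerable (ℕ ⊕ Set.Iio β)
    exact ⟨(Denumerable.eqv _).symm⟩
  replace e (β : I) : ℕ ≃ ℕ ⊕ Set.Iio β := (e β).some
  have hext' (p : ℕ → X) : ∃ q, (∀ j, good (p j)) → (∀ i j, i ≠ j → r (p i) (p j)) →
      good q ∧ (∀ j, r (p j) q ∧ r q (p j)) ∧ ∀ j, ∀ n ≤ j, c n (p j) q := by
    by_cases h : (∀ j, good (p j)) ∧ ∀ i j, i ≠ j → r (p i) (p j)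
    · obtain ⟨q, hq⟩ := hext p h.1 h.2
      exact ⟨q, fun _ _ => hq⟩
    · exact ⟨R 0, fun h1 h2 => (h ⟨h1, h2⟩).elim⟩
  choose G hG using hext'
  let P : I → X := wellFounded_lt.fix fun β ih => G fun k =>
    Sum.elim R (fun α : Set.Iio β => ih α.1 α.2) (e β k)
  let p (β : I) : ℕ ⊕ Set.Iio β → X := Sum.elim R fun α => P α
  have hPβ (β : I) : P β = G fun k => p β (e β k) := wellFounded_lt.fix_eq _ β
  have key (β : I) : good (P β) ∧ (∀ x, r (p β x) (P β) ∧ r (P β) (p β x)) ∧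
      ∀ j, ∀ n ≤ j, c n (p β (e β j)) (P β) := by
    induction β using WellFoundedLT.induction with
    | ind β ih =>
      have hgood (x : ℕ ⊕ Set.Iio β) : good (p β x) := by
        rcases x with n | α
        · exact hR n
        · exact (ih α.1 α.2).1
      have hr (x y : ℕ ⊕ Set.Iio β) (hxy : x ≠ y) : r (p β x) (p β y) := by
        rcases x with m | α <;> rcases y with n | γ
        · exact hRr m n fun h => hxy (h ▸ rfl)
        · exact ((ih γ.1 γ.2).2.1 (.inl m)).1
        · exact ((ih α.1 α.2).2.1 (.inl n)).2
        · have hne : α.1 ≠ γ.1 := fun h => hxy (congrArg Sum.inr (Subtype.ext h))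
          rcases hne.lt_or_gt with h | h
          · exact ((ih γ.1 γ.2).2.1 (.inr ⟨α.1, h⟩)).1
          · exact ((ih α.1 α.2).2.1 (.inr ⟨γ.1, h⟩)).2
      obtain ⟨h1, h2, h3⟩ := hG (fun k => p β (e β k)) (fun j => hgood _)
        fun i j hij => hr _ _ ((e β).injective.ne hij)
      rw [← hPβ] at h1 h2 h3
      refine ⟨h1, fun x => ?_, h3⟩
      simpa using h2 ((e β).symm x)
  refine ⟨P, fun α => (key α).1, fun α β hne => ?_, fun β n => ?_⟩
  · rcases hne.lt_or_gt with h | h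
    · exact ((key β).2.1 (.inr ⟨α, h⟩)).1
    · exact ((key α).2.1 (.inr ⟨β, h⟩)).2
  · refine ⟨(Finset.range n).image fun k => Sum.elim (fun _ => β) Subtype.val (e β k),
      Finset.card_image_le.trans (Finset.card_range n).le, ?_⟩
    rintro α ⟨hα, hc⟩
    have hk : e β ((e β).symm (.inr ⟨α, hα⟩)) = .inr ⟨α, hα⟩ := Equiv.apply_symm_apply _ _
    simp only [Finset.coe_image, Set.mem_image, Finset.mem_coe, Finset.mem_range]
    refine ⟨(e β).symm (.inr ⟨α, hα⟩), ?_, by rw [hk]; rfl⟩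
    by_contra! hn
    refine hc ?_
    have := (key β).2.2 _ n hn
    rwa [hk] at this

/-- The Farah–Wofsey lemma: given compact operators `(K n)` on a separable
infinite-dimensional Hilbert space `H` and `0 < ε < 1/2`, there are infinite-rank projections
`(P α)_{α < ω₁}` with `P α * P β` compact for distinct `α, β`, and such that for every
`β < ω₁` and `n ∈ ℕ`, all but at most `n` ordinals `α < β` satisfy
`‖(P α + K n)(P β + K n) − (P β + K n)(P α + K n)‖ ≥ ε`. -/
theorem farah_wofsey_lemma
    {H : Type*} [NormedAddCommGroup H] [InnerProductSpace ℂ H] [CompleteSpace H]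
    [TopologicalSpace.SeparableSpace H] (hH : ¬ FiniteDimensional ℂ H)
    (K : ℕ → H →L[ℂ] H) (hK : ∀ n, IsCompactOperator (K n))
    (ε : ℝ) (hε₀ : 0 < ε) (hε₁ : ε < 1 / 2) :
    ∃ P : {α : Ordinal // α < ω₁} → H →L[ℂ] H,
      (∀ α, IsSelfAdjoint (P α) ∧ IsIdempotentElem (P α)) ∧
      (∀ α, ¬ FiniteDimensional ℂ (LinearMap.range (P α : H →ₗ[ℂ] H))) ∧
      (∀ α β, α ≠ β → IsCompactOperator (P α * P β : H →L[ℂ] H)) ∧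
      (∀ β : {α : Ordinal // α < ω₁}, ∀ n : ℕ,
        ∃ F : Finset {α : Ordinal // α < ω₁}, F.card ≤ n ∧
          {α : {α : Ordinal // α < ω₁} | α < β ∧
            ‖(P α + K n) * (P β + K n) - (P β + K n) * (P α + K n)‖ < ε} ⊆ ↑F) := by
  obtain ⟨R, hR, hRR⟩ := exists_pairwise_mul_eq_zero hH
  obtain ⟨P, hP, hPP, hPc⟩ := exists_family_of_sequence_extension
    (I := {α : Ordinal // α < ω₁}) (good := IsInfiniteProjection)
    (r := fun A B => IsCompactOperator (A * B : H →L[ℂ] H))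
    (c := fun n A B => ε ≤ ‖(A + K n) * (B + K n) - (B + K n) * (A + K n)‖)
    Ordinal.countable_Iio_of_lt_omega_one hR
    (fun m n hmn => by rw [hRR m n hmn]; exact isCompactOperator_zero)
    fun p hp hpp => exists_almost_orthogonal_projection hp hpp hK hε₁
  refine ⟨P, fun α => ⟨(hP α).isStarProjection.isSelfAdjoint,
    (hP α).isStarProjection.isIdempotentElem⟩, fun α => (hP α).not_finiteDimensional, hPP, ?_⟩
  simpa only [not_le] using hPc
end

section
/- Let H be a separable infinite-dimensional complex Hilbert space. There exists a family (P_α)_{α<ω₁} of projections in B(H), none of which is compact, such that P_α P_β is compact and P_α − P_β is not compact for all distinct α, β < ω₁, and such that for every uncountable set S ⊆ ω₁ there is no family (Q_α)_{α∈S} of pairwise commuting projections in B(H) with Q_α − P_α compact for every α ∈ S. -/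
open scoped Ordinal
open InnerProductSpace Filter

/-- Well-founded choice: if every partial solution below `i` extends to `i`, there is a
global solution. -/
theorem exists_forall_of_wellFoundedLT {ι X : Type*} [Preorder ι] [WellFoundedLT ι] [Nonempty X]
    (T : ∀ i : ι, (Set.Iio i → X) → X → Prop)
    (h : ∀ (i : ι) (f : ι → X), (∀ j < i, T j (fun k => f k) (f j)) →
      ∃ x, T i (fun k => f k) x) :
    ∃ f : ι → X, ∀ i, T i (fun k => f k) (f i) := by
  classical
  let F : ι → X := (wellFounded_lt (α := ι)).fix fun i rec =>
    Classical.epsilon (T i fun k => rec k k.2)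
  have hF : ∀ i, F i = Classical.epsilon (T i fun k => F k) := fun i =>
    (wellFounded_lt (α := ι)).fix_eq _ i
  refine ⟨F, fun i => ?_⟩
  induction i using WellFoundedLT.induction with
  | ind i ih =>
    rw [hF i]
    exact Classical.epsilon_spec (h i F ih)

section Hilbert

variable {H : Type*} [NormedAddCommGroup H] [InnerProductSpace ℂ H]

theorem exists_orthonormal_mem {C : ℕ → Set H}
    (hC : ∀ n, ∀ G : Set H, G.Finite → ∃ x ∈ C n, ‖x‖ = 1 ∧ ∀ g ∈ G, inner ℂ g x = 0) :
    ∃ e : ℕ → H, Orthonormal ℂ e ∧ ∀ n, e n ∈ C n := by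
  obtain ⟨e, he⟩ := exists_forall_of_wellFoundedLT
    (fun (n : ℕ) (f : Set.Iio n → H) (x : H) =>
      x ∈ C n ∧ ‖x‖ = 1 ∧ ∀ k, inner ℂ (f k) x = 0) (fun n f _ => by
        obtain ⟨x, hx, hx1, hG⟩ :=
          hC n (Set.range fun k : Set.Iio n => f k) (Set.finite_range _)
        exact ⟨x, hx, hx1, fun k => hG _ ⟨k, rfl⟩⟩)
  have hlt : ∀ i j, i < j → inner ℂ (e i) (e j) = 0 := fun i j hij => (he j).2.2 ⟨i, hij⟩
  refine ⟨e, ⟨fun n => (he n).2.1, fun i j hij => ?_⟩, fun n => (he n).1⟩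
  rcases hij.lt_or_gt with h | h
  · exact hlt i j h
  · exact inner_eq_zero_symm.1 (hlt j i h)

theorem not_isCompactOperator_of_orthonormal_fixed [CompleteSpace H] {P : H →L[ℂ] H} {e : ℕ → H}
    (he : Orthonormal ℂ e) (hP : ∀ n, P (e n) = e n) : ¬ IsCompactOperator P := by
  intro hc
  have := ContinuousLinearMap.finite_dimensional_eigenspace hc 1 one_ne_zero
  have hmem : ∀ n, e n ∈ Module.End.eigenspace P.toLinearMap (1 : ℂ) := fun n => by
    simp [hP]
  have hli : LinearIndependent ℂ
      (fun n => (⟨e n, hmem n⟩ : Module.End.eigenspace P.toLinearMap (1 : ℂ))) :=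
    LinearIndependent.of_comp (Submodule.subtype _) he.linearIndependent
  exact (Set.infinite_univ (α := ℕ)) (Set.finite_univ_iff.2 hli.finite)

theorem exists_unit_fixed_orthogonal_of_not_isCompactOperator {P : H →L[ℂ] H}
    (hP : IsIdempotentElem P) (hc : ¬ IsCompactOperator P) {G : Set H} (hG : G.Finite) :
    ∃ x, P x = x ∧ ‖x‖ = 1 ∧ ∀ g ∈ G, inner ℂ g x = 0 := by
  by_contra! hcon
  have hPP : ∀ x, P (P x) = P x := fun x => congrArg (fun T : H →L[ℂ] H => T x) hP.eq
  have : Finite G := hG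
  let L : P.range →ₗ[ℂ] (G → ℂ) :=
    LinearMap.pi (fun g => (innerSL ℂ (g : H)).toLinearMap ∘ₗ P.range.subtype)
  have hL : Function.Injective L := by
    rw [← LinearMap.ker_eq_bot, LinearMap.ker_eq_bot']
    rintro ⟨y, x, rfl⟩ hy
    by_contra hne
    have hne' : P x ≠ 0 := fun h => hne (Subtype.ext h)
    obtain ⟨g, hg, hgx⟩ := hcon ((‖P x‖⁻¹ : ℂ) • P x) (by simp [hPP])
      (by simp [norm_smul, hne'])
    apply hgx
    have hgP : inner ℂ g (P x) = 0 := congrFun hy ⟨g, hg⟩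
    rw [inner_smul_right, hgP, mul_zero]
  have : FiniteDimensional ℂ P.range := FiniteDimensional.of_injective L hL
  apply hc
  have h1 : IsCompactOperator (id : P.range → P.range) :=
    (isCompactOperator_id_iff_finiteDimensional (𝕜 := ℂ)).2 this
  exact (h1.comp_clm P.rangeRestrict).clm_comp P.range.subtypeL

theorem exists_finite_orthogonal_norm_le [CompleteSpace H] {K : H →L[ℂ] H}
    (hK : IsCompactOperator (star K : H →L[ℂ] H)) {D : Set H} (hD : Dense D) {ε : ℝ} (hε : 0 < ε) :
    ∃ G ⊆ D, G.Finite ∧ ∀ x, (∀ g ∈ G, inner ℂ g x = 0) → ‖K x‖ ≤ ε * ‖x‖ := by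
  have hc := hK.isCompact_closure_image_closedBall 1
  obtain ⟨G, hGD, hG⟩ := hc.elim_finite_subcover_image (b := D)
    (c := fun d => Metric.ball d ε) (fun _ _ => Metric.isOpen_ball) (fun y _ => by
      obtain ⟨d, hd, hdy⟩ := hD.exists_dist_lt y hε
      exact Set.mem_biUnion hd (Metric.mem_ball.2 hdy))
  refine ⟨G, hGD, hG.1, fun x hx => ?_⟩
  rcases eq_or_ne (K x) 0 with h0 | h0
  · rw [h0, norm_zero]; positivity
  set y : H := ((‖K x‖⁻¹ : ℝ) : ℂ) • K x with hy
  have hy1 : ‖y‖ = 1 := by simp [hy, norm_smul, h0]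
  obtain ⟨d, hd, hdy⟩ := Set.mem_iUnion₂.1 <| hG.2 <| subset_closure
    ⟨y, by simp [hy1], rfl⟩
  have h1 : inner ℂ y (K x) = (‖K x‖ : ℂ) := by
    rw [hy, inner_smul_left, inner_self_eq_norm_sq_to_K]
    have : (‖K x‖ : ℂ) ≠ 0 := by exact_mod_cast norm_ne_zero_iff.2 h0
    simp; field_simp
  have h2 : inner ℂ y (K x) = inner ℂ (star K y - d) x := by
    rw [inner_sub_left, hx d hd, sub_zero, ContinuousLinearMap.star_eq_adjoint,
      ContinuousLinearMap.adjoint_inner_left]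
  calc ‖K x‖ = ‖inner ℂ y (K x)‖ := by rw [h1]; simp
    _ ≤ ‖star K y - d‖ * ‖x‖ := by rw [h2]; exact norm_inner_le_norm _ _
    _ ≤ ε * ‖x‖ := by
      gcongr
      exact (mem_ball_iff_norm.1 hdy).le

theorem IsStarProjection.norm_apply_le [CompleteSpace H] {P : H →L[ℂ] H} (hP : IsStarProjection P)
    (x : H) : ‖P x‖ ≤ ‖x‖ := by
  obtain ⟨K, _, rfl⟩ := isStarProjection_iff_eq_starProjection.1 hP
  exact K.norm_starProjection_apply_le x

theorem IsStarProjection.inner_apply_left [CompleteSpace H] {P : H →L[ℂ] H}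
    (hP : IsStarProjection P) (x y : H) : inner ℂ (P x) y = inner ℂ x (P y) :=
  ContinuousLinearMap.isSelfAdjoint_iff_isSymmetric.1 hP.isSelfAdjoint x y

theorem isCompactOperator_rankOne_s12 (x y : H) : IsCompactOperator (rankOne ℂ x y : H →L[ℂ] H) := by
  have h : IsCompactOperator (id : ℂ → ℂ) :=
    (isCompactOperator_id_iff_finiteDimensional (𝕜 := ℂ)).2 inferInstance
  exact (h.comp_clm (innerSL ℂ y)).clm_comp (ContinuousLinearMap.toSpanSingleton ℂ x)

theorem isCompactOperator_mul_starProjection_span [CompleteSpace H] {w : ℕ → H}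
    (hw : Orthonormal ℂ w) {A : H →L[ℂ] H} (hA : Summable fun k => ‖A (w k)‖) :
    let P := (Submodule.span ℂ (Set.range w)).topologicalClosure.starProjection
    IsCompactOperator (A * P : H →L[ℂ] H) ∧ IsCompactOperator (star (A * P) : H →L[ℂ] H) := by
  intro P
  have hsum : Summable fun k => (rankOne ℂ (A (w k)) (w k) : H →L[ℂ] H) :=
    Summable.of_norm (by simpa [hw.1] using hA)
  set T := ∑' k, (rankOne ℂ (A (w k)) (w k) : H →L[ℂ] H)
  have hT : HasSum (fun k => (rankOne ℂ (A (w k)) (w k) : H →L[ℂ] H)) T := hsum.hasSum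
  have happ : ∀ x, HasSum (fun k => inner ℂ (w k) x • A (w k)) (T x) := fun x => by
    simpa using hT.mapL (ContinuousLinearMap.apply ℂ H x)
  have hTw : Set.EqOn T A (Set.range w) := by
    rintro _ ⟨j, rfl⟩
    refine (happ (w j)).unique ?_
    convert hasSum_single j fun k hk => ?_ using 1
    · simp [hw.1]
    · simp [hw.2 hk]
  have hPw : ∀ k, P (w k) = w k := fun k => Submodule.starProjection_eq_self_iff.2 <|
    Submodule.le_topologicalClosure _ (Submodule.subset_span ⟨k, rfl⟩)
  have hTP : T = A * P := by
    ext x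
    have h1 : T (P x) = A (P x) :=
      ContinuousLinearMap.eqOn_closure_span hTw <|
      (Submodule.span ℂ (Set.range w)).topologicalClosure.starProjection_apply_mem x
    have h2 : T (P x) = T x := by
      refine (happ (P x)).unique ?_
      have h3 : ∀ k, inner ℂ (w k) (P x) = inner ℂ (w k) x := fun k => by
        rw [← isStarProjection_starProjection.inner_apply_left, hPw]
      simpa only [h3] using happ x
    rw [← h2, h1]; rfl
  rw [← hTP]
  refine ⟨isCompactOperator_of_tendsto hT (.of_forall fun s => ?_),
    isCompactOperator_of_tendsto hT.star (.of_forall fun s => ?_)⟩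
  · exact (compactOperator (RingHom.id ℂ) H H).sum_mem fun k _ => isCompactOperator_rankOne_s12 _ _
  · refine (compactOperator (RingHom.id ℂ) H H).sum_mem fun k _ => ?_
    rw [ContinuousLinearMap.star_eq_adjoint, adjoint_rankOne]
    exact isCompactOperator_rankOne_s12 _ _

/-- `P` and `A` fail to commute by a definite amount on some pair of unit vectors orthogonal
to `F`. -/
def IsTwistedOff (F : Set H) (P A : H →L[ℂ] H) : Prop :=
  ∃ u v : H, ‖u‖ = 1 ∧ ‖v‖ = 1 ∧ (∀ g ∈ F, inner ℂ g u = 0 ∧ inner ℂ g v = 0) ∧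
    ‖A u‖ ≤ 1 / 10 ∧ A v = v ∧ inner ℂ (P u) v = 1 / 2

theorem IsTwistedOff.not_commute [CompleteSpace H] {F : Set H} {P A Q R : H →L[ℂ] H}
    (h : IsTwistedOff F P A) (hP : IsStarProjection P)
    (hQ : IsStarProjection Q) (hR : IsStarProjection R)
    (hQP : ∀ x, (∀ g ∈ F, inner ℂ g x = 0) → ‖(Q - P) x‖ ≤ 1 / 20 * ‖x‖)
    (hRA : ∀ x, (∀ g ∈ F, inner ℂ g x = 0) → ‖(R - A) x‖ ≤ 1 / 20 * ‖x‖) :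
    Q * R ≠ R * Q := by
  intro hcomm
  obtain ⟨u, v, hu, hv, hF, hAu, hAv, huv⟩ := h
  have hQu := hQP u fun g hg => (hF g hg).1
  have hRu := hRA u fun g hg => (hF g hg).1
  have hRv := hRA v fun g hg => (hF g hg).2
  rw [sub_apply, hu] at hQu hRu
  rw [sub_apply, hv, hAv] at hRv
  have hswap : inner ℂ (Q u) (R v) = inner ℂ (R u) (Q v) := by
    rw [← hR.inner_apply_left, ← hQ.inner_apply_left]
    exact congrArg (fun T : H →L[ℂ] H => inner ℂ (T u) v) hcomm.symm
  have hsplit : (1 / 2 : ℂ) =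
      inner ℂ (R u) (Q v) - inner ℂ (Q u - P u) (R v) - inner ℂ (P u) (R v - v) := by
    rw [← hswap, ← huv, inner_sub_left, inner_sub_right]; ring
  have h1 : ‖inner ℂ (R u) (Q v)‖ ≤ 3 / 20 := by
    have hRu' : ‖R u‖ ≤ 3 / 20 := by
      have := norm_add_le (R u - A u) (A u)
      rw [sub_add_cancel] at this
      linarith
    have := mul_le_mul hRu' ((hQ.norm_apply_le v).trans_eq hv) (norm_nonneg _) (by norm_num)
    linarith [norm_inner_le_norm (𝕜 := ℂ) (R u) (Q v)]
  have h2 : ‖inner ℂ (Q u - P u) (R v)‖ ≤ 1 / 20 := by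
    have := mul_le_mul hQu ((hR.norm_apply_le v).trans_eq hv) (norm_nonneg _) (by norm_num)
    linarith [norm_inner_le_norm (𝕜 := ℂ) (Q u - P u) (R v)]
  have h3 : ‖inner ℂ (P u) (R v - v)‖ ≤ 1 / 20 := by
    have := mul_le_mul ((hP.norm_apply_le u).trans_eq hu) hRv (norm_nonneg _) (by norm_num)
    linarith [norm_inner_le_norm (𝕜 := ℂ) (P u) (R v - v)]
  have h4 : ‖(1 / 2 : ℂ)‖ = 1 / 2 := by norm_num
  rw [hsplit] at h4
  linarith [norm_sub_le (inner ℂ (R u) (Q v) - inner ℂ (Q u - P u) (R v))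
      (inner ℂ (P u) (R v - v)),
    norm_sub_le (inner ℂ (R u) (Q v)) (inner ℂ (Q u - P u) (R v))]

theorem exists_unit_fixed_orthogonal_norm_le [CompleteSpace H] {A : ℕ → H →L[ℂ] H}
    (hA : ∀ n, IsStarProjection (A n)) (hc : ∀ n, ¬ IsCompactOperator (A n))
    (hAA : ∀ m n, m ≠ n → IsCompactOperator (A m * A n : H →L[ℂ] H)) (n : ℕ) {ε : ℝ} (hε : 0 < ε)
    {G : Set H} (hG : G.Finite) :
    ∃ x, A n x = x ∧ ‖x‖ = 1 ∧ (∀ g ∈ G, inner ℂ g x = 0) ∧ ∀ m < n, ‖A m x‖ ≤ ε := by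
  have hfin : ∀ m : Set.Iio n, ∃ F : Set H, F.Finite ∧
      ∀ x, (∀ g ∈ F, inner ℂ g x = 0) → ‖(A m * A n) x‖ ≤ ε * ‖x‖ := fun m => by
    obtain ⟨F, -, hF⟩ := exists_finite_orthogonal_norm_le (K := A m * A n) (by
      rw [star_mul, (hA n).isSelfAdjoint.star_eq, (hA m).isSelfAdjoint.star_eq]
      exact hAA n m (ne_of_gt m.2)) dense_univ hε
    exact ⟨F, hF⟩
  choose F hF hFle using hfin
  obtain ⟨x, hx, hx1, hxG⟩ := exists_unit_fixed_orthogonal_of_not_isCompactOperator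
    (hA n).isIdempotentElem (hc n) (hG.union (Set.finite_iUnion hF))
  refine ⟨x, hx, hx1, fun g hg => hxG g (.inl hg), fun m hm => ?_⟩
  have := hFle ⟨m, hm⟩ x fun g hg => hxG g (.inr (Set.mem_iUnion.2 ⟨⟨m, hm⟩, hg⟩))
  simpa [hx, hx1] using this

theorem orthonormal_smul_add {e : ℕ → H} (he : Orthonormal ℂ e) :
    Orthonormal ℂ fun k => ((√2 : ℝ) : ℂ)⁻¹ • (e (2 * k) + e (2 * k + 1)) := by
  rw [orthonormal_iff_ite] at he ⊢
  intro i j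
  have h2 : ((√2 : ℝ) : ℂ) * ((√2 : ℝ) : ℂ) = 2 := by
    rw [← Complex.ofReal_mul, Real.mul_self_sqrt (by norm_num)]; norm_num
  have h3 : ((√2 : ℝ) : ℂ) ≠ 0 := fun h => by simp [h] at h2
  have e1 : ¬ 2 * i = 2 * j + 1 := by omega
  have e2 : ¬ 2 * i + 1 = 2 * j := by omega
  simp only [inner_smul_left, inner_smul_right, inner_add_left, inner_add_right, he, map_inv₀,
    Complex.conj_ofReal, e1, e2, if_false, add_left_inj, Nat.mul_right_inj two_ne_zero]
  split_ifs
  · field_simp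
    rw [pow_two, h2]; norm_num
  · simp

theorem exists_isStarProjection_isTwistedOff [CompleteSpace H] (d : ℕ → H) {A : ℕ → H →L[ℂ] H}
    (hA : ∀ n, IsStarProjection (A n)) (hc : ∀ n, ¬ IsCompactOperator (A n))
    (hAA : ∀ m n, m ≠ n → IsCompactOperator (A m * A n : H →L[ℂ] H)) :
    ∃ P : H →L[ℂ] H, IsStarProjection P ∧ ¬ IsCompactOperator P ∧
      (∀ n, IsCompactOperator (A n * P : H →L[ℂ] H) ∧
        IsCompactOperator (P * A n : H →L[ℂ] H)) ∧
      ∀ n, IsTwistedOff (d '' Set.Iic n) P (A n) := by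
  obtain ⟨e, he, heC⟩ := exists_orthonormal_mem
    (C := fun j => {x | A ((j + 1) / 2) x = x ∧ (∀ g ∈ d '' Set.Iic (j / 2), inner ℂ g x = 0) ∧
      ∀ m < (j + 1) / 2, ‖A m x‖ ≤ (1 / 2) ^ (j / 2) / 10}) (fun j G hG => by
        obtain ⟨x, h1, h2, h3, h4⟩ := exists_unit_fixed_orthogonal_norm_le hA hc hAA ((j + 1) / 2)
          (ε := (1 / 2) ^ (j / 2) / 10) (by positivity)
          (hG.union ((Set.finite_Iic (j / 2)).image d))
        exact ⟨x, ⟨h1, fun g hg => h3 g (.inr hg), h4⟩, h2, fun g hg => h3 g (.inl hg)⟩)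
  have hev : ∀ k, A k (e (2 * k)) = e (2 * k) ∧
      (∀ g ∈ d '' Set.Iic k, inner ℂ g (e (2 * k)) = 0) ∧
      ∀ m < k, ‖A m (e (2 * k))‖ ≤ (1 / 2) ^ k / 10 := fun k => by
    have := heC (2 * k)
    simpa only [Set.mem_ofPred_eq, show (2 * k + 1) / 2 = k by omega,
      show 2 * k / 2 = k by omega] using this
  have hod : ∀ k, A (k + 1) (e (2 * k + 1)) = e (2 * k + 1) ∧
      (∀ g ∈ d '' Set.Iic k, inner ℂ g (e (2 * k + 1)) = 0) ∧
      ∀ m < k + 1, ‖A m (e (2 * k + 1))‖ ≤ (1 / 2) ^ k / 10 := fun k => by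
    have := heC (2 * k + 1)
    simpa only [Set.mem_ofPred_eq, show (2 * k + 1 + 1) / 2 = k + 1 by omega,
      show (2 * k + 1) / 2 = k by omega] using this
  set c : ℂ := ((√2 : ℝ) : ℂ)⁻¹ with hcdef
  have hc0 : c ≠ 0 := by simp [hcdef]
  have hc1 : ‖c‖ ≤ 1 := by
    rw [hcdef, norm_inv, Complex.norm_real, Real.norm_of_nonneg (by positivity)]
    exact inv_le_one_of_one_le₀ (Real.one_le_sqrt.2 (by norm_num))
  set w : ℕ → H := fun k => c • (e (2 * k) + e (2 * k + 1)) with hwdef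
  have hw : Orthonormal ℂ w := orthonormal_smul_add he
  set W := (Submodule.span ℂ (Set.range w)).topologicalClosure
  have hP : IsStarProjection W.starProjection := isStarProjection_starProjection
  have hwW : ∀ k, w k ∈ W := fun k =>
    Submodule.le_topologicalClosure _ (Submodule.subset_span ⟨k, rfl⟩)
  have hsum : ∀ m, Summable fun k => ‖A m (w k)‖ := fun m => by
    refine Summable.of_norm_bounded_eventually_nat (g := fun k => (1 / 2 : ℝ) ^ k)
      (summable_geometric_of_lt_one (by norm_num) (by norm_num)) ?_
    filter_upwards [eventually_gt_atTop m] with k hk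
    have h1 := (hev k).2.2 m hk
    have h2 := (hod k).2.2 m (by omega)
    have h3 := norm_add_le (A m (e (2 * k))) (A m (e (2 * k + 1)))
    have h4 : (0 : ℝ) ≤ (1 / 2) ^ k := by positivity
    rw [norm_norm, hwdef, map_smul, map_add, norm_smul]
    calc ‖c‖ * ‖A m (e (2 * k)) + A m (e (2 * k + 1))‖
        ≤ 1 * ‖A m (e (2 * k)) + A m (e (2 * k + 1))‖ := by gcongr
      _ ≤ (1 / 2) ^ k := by linarith
  refine ⟨W.starProjection, hP, not_isCompactOperator_of_orthonormal_fixed hw fun k =>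
    Submodule.starProjection_eq_self_iff.2 (hwW k), fun n => ?_, fun n => ?_⟩
  · obtain ⟨h1, h2⟩ := isCompactOperator_mul_starProjection_span hw (hsum n)
    rw [star_mul, (hA n).isSelfAdjoint.star_eq, hP.isSelfAdjoint.star_eq] at h2
    exact ⟨h1, h2⟩
  · refine ⟨e (2 * n + 1), e (2 * n), he.1 _, he.1 _,
      fun g hg => ⟨(hod n).2.1 g hg, (hev n).2.1 g hg⟩, ?_, (hev n).1, ?_⟩
    · refine ((hod n).2.2 n n.lt_succ_self).trans ?_
      have : (1 / 2 : ℝ) ^ n ≤ 1 := pow_le_one₀ (by norm_num) (by norm_num)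
      linarith
    · have hmem : (1 / 2 : ℂ) • (e (2 * n) + e (2 * n + 1)) ∈ W := by
        have := W.smul_mem (1 / 2 * c⁻¹) (hwW n)
        rwa [hwdef, smul_smul, mul_assoc, inv_mul_cancel₀ hc0, mul_one] at this
      have horth : (1 / 2 : ℂ) • (e (2 * n + 1) - e (2 * n)) ∈ Wᗮ := by
        refine Submodule.smul_mem _ _ ?_
        rw [Submodule.orthogonal_closure]
        refine (Submodule.isOrtho_span.2 ?_).symm.le (Submodule.mem_span_singleton_self _)
        rintro _ ⟨j, rfl⟩ _ rfl
        have h1 : ¬ 2 * j = 2 * n + 1 := by omega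
        have h2 : ¬ 2 * j + 1 = 2 * n := by omega
        simp [hwdef, inner_smul_left, inner_add_left, inner_sub_right,
          orthonormal_iff_ite.1 he, h1, h2]
      have hPu : W.starProjection (e (2 * n + 1)) = (1 / 2 : ℂ) • (e (2 * n) + e (2 * n + 1)) :=
        Submodule.eq_starProjection_of_mem_orthogonal' hmem horth (by module)
      rw [hPu]
      have h0 := he.2 (show 2 * n + 1 ≠ 2 * n by omega)
      rw [inner_smul_left, inner_add_left, h0, inner_self_eq_norm_sq_to_K, he.1]
      simp [Complex.conj_ofNat]

theorem exists_pairwise_orthogonal_not_isCompactOperator [CompleteSpace H]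
    (hH : ¬ FiniteDimensional ℂ H) :
    ∃ B : ℕ → H →L[ℂ] H, (∀ n, IsStarProjection (B n)) ∧ (∀ n, ¬ IsCompactOperator (B n)) ∧
      ∀ m n, m ≠ n → B m * B n = 0 := by
  have hid : ¬ IsCompactOperator (1 : H →L[ℂ] H) := fun h =>
    hH ((isCompactOperator_id_iff_finiteDimensional (𝕜 := ℂ)).1 h)
  obtain ⟨e, he, -⟩ := exists_orthonormal_mem (C := fun _ => (Set.univ : Set H)) fun _ G hG => by
    obtain ⟨x, -, hx⟩ := exists_unit_fixed_orthogonal_of_not_isCompactOperator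
      IsIdempotentElem.one hid hG
    exact ⟨x, trivial, hx⟩
  let f : ℕ → ℕ → H := fun n k => e (Nat.pair n k)
  have hf : ∀ n, Orthonormal ℂ (f n) := fun n =>
    he.comp _ fun a b hab => (Nat.pair_eq_pair.1 hab).2
  let W : ℕ → Submodule ℂ H := fun n => (Submodule.span ℂ (Set.range (f n))).topologicalClosure
  refine ⟨fun n => (W n).starProjection, fun n => isStarProjection_starProjection, fun n =>
    not_isCompactOperator_of_orthonormal_fixed (hf n) fun k =>
      Submodule.starProjection_eq_self_iff.2 <|
        Submodule.le_topologicalClosure _ (Submodule.subset_span ⟨k, rfl⟩), fun m n hmn => ?_⟩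
  refine Submodule.IsOrtho.starProjection_comp_starProjection ?_
  refine Submodule.topologicalClosure_minimal _ ?_ (W n).isClosed_orthogonal
  rw [Submodule.orthogonal_closure]
  refine Submodule.isOrtho_span.2 ?_
  rintro _ ⟨j, rfl⟩ _ ⟨k, rfl⟩
  exact he.2 fun h => hmn (Nat.pair_eq_pair.1 h).1

end Hilbert

theorem countable_Iic_subtype_lt_omega_one (α : {α : Ordinal // α < ω₁}) :
    (Set.Iic α).Countable := by
  have hc : (Set.Iio α.1).Countable := by
    rw [← Cardinal.le_aleph0_iff_set_countable, Cardinal.mk_Iio_ordinal, Cardinal.lift_le_aleph0,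
      ← Cardinal.lt_aleph_one_iff]
    exact Cardinal.lt_ord.1 (by simpa using α.2)
  have : (Set.Iio α).Countable :=
    Set.MapsTo.countable_of_injOn (f := Subtype.val) (fun _ h => h)
      Subtype.val_injective.injOn hc
  rw [← Set.Iio_insert]
  exact this.insert α

theorem exists_infinite_inter_Iio_of_not_countable {S : Set {α : Ordinal // α < ω₁}}
    (hS : ¬ S.Countable) : ∃ α ∈ S, (S ∩ Set.Iio α).Infinite := by
  have hinf : S.Infinite := fun h => hS h.countable
  obtain ⟨α, hα, h⟩ : ∃ α ∈ S, α ∉ ⋃ n, Set.Iic (hinf.natEmbedding S n).1 := by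
    by_contra! hcon
    exact hS ((Set.countable_iUnion fun n => countable_Iic_subtype_lt_omega_one _).mono hcon)
  refine ⟨α, hα, Set.infinite_of_injective_forall_mem
    (Subtype.val_injective.comp (hinf.natEmbedding S).injective) fun n => ⟨Subtype.mem _, ?_⟩⟩
  simp only [Set.mem_iUnion, Set.mem_Iic, not_exists, not_le] at h
  exact h n

/-- There are `ℵ₁` projections on a separable infinite-dimensional Hilbert space whose images
in the Calkin algebra are pairwise orthogonal and pairwise distinct, such that no uncountable
subfamily can be lifted to commuting projections in `B(H)`. -/
theorem exists_projections_no_uncountable_commuting_projection_lift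
    {H : Type*} [NormedAddCommGroup H] [InnerProductSpace ℂ H] [CompleteSpace H]
    [TopologicalSpace.SeparableSpace H] (hH : ¬ FiniteDimensional ℂ H) :
    ∃ P : {α : Ordinal // α < ω₁} → H →L[ℂ] H,
      (∀ α, IsSelfAdjoint (P α) ∧ IsIdempotentElem (P α)) ∧
      (∀ α, ¬ IsCompactOperator (P α : H →L[ℂ] H)) ∧
      (∀ α β, α ≠ β → IsCompactOperator (P α * P β : H →L[ℂ] H)) ∧
      (∀ α β, α ≠ β → ¬ IsCompactOperator (P α - P β : H →L[ℂ] H)) ∧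
      (∀ S : Set {α : Ordinal // α < ω₁}, ¬ S.Countable →
        ¬ ∃ Q : {α : Ordinal // α < ω₁} → H →L[ℂ] H,
          (∀ α ∈ S, IsSelfAdjoint (Q α) ∧ IsIdempotentElem (Q α)) ∧
          (∀ α ∈ S, ∀ β ∈ S, Q α * Q β = Q β * Q α) ∧
          (∀ α ∈ S, IsCompactOperator (Q α - P α : H →L[ℂ] H))) := by
  obtain ⟨B, hB, hBc, hBB⟩ := exists_pairwise_orthogonal_not_isCompactOperator hH
  obtain ⟨P, hP⟩ := exists_forall_of_wellFoundedLT
    (fun (α : {α : Ordinal // α < ω₁}) (f : Set.Iio α → H →L[ℂ] H) (P : H →L[ℂ] H) =>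
      IsStarProjection P ∧ ¬ IsCompactOperator P ∧
      (∀ n, IsCompactOperator (B n * P : H →L[ℂ] H) ∧ IsCompactOperator (P * B n : H →L[ℂ] H)) ∧
      (∀ β, IsCompactOperator (f β * P : H →L[ℂ] H) ∧ IsCompactOperator (P * f β : H →L[ℂ] H)) ∧
      ∀ n, {β | ¬ IsTwistedOff (TopologicalSpace.denseSeq H '' Set.Iic n) P (f β)}.Finite) (by
    intro α f hf
    have : Countable (Set.Iio α) :=
      ((countable_Iic_subtype_lt_omega_one α).mono Set.Iio_subset_Iic_self).to_subtype
    obtain ⟨φ⟩ : Nonempty (ℕ ≃ ℕ ⊕ Set.Iio α) := inferInstance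
    let A : ℕ ⊕ Set.Iio α → H →L[ℂ] H := Sum.elim B fun β => f β
    have hA : ∀ i, IsStarProjection (A i) := by
      rintro (n | β)
      exacts [hB n, (hf β β.2).1]
    have hAc : ∀ i, ¬ IsCompactOperator (A i) := by
      rintro (n | β)
      exacts [hBc n, (hf β β.2).2.1]
    have hAA : ∀ i j, i ≠ j → IsCompactOperator (A i * A j : H →L[ℂ] H) := by
      rintro (m | β) (n | γ) hne
      · have h0 : A (.inl m) * A (.inl n) = 0 := hBB m n fun h => hne (congrArg _ h)
        rw [h0]
        exact isCompactOperator_zero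
      · exact ((hf γ γ.2).2.2.1 m).1
      · exact ((hf β β.2).2.2.1 n).2
      · rcases lt_trichotomy β γ with h | h | h
        · exact ((hf γ γ.2).2.2.2.1 ⟨β, h⟩).1
        · exact absurd (congrArg _ h) hne
        · exact ((hf β β.2).2.2.2.1 ⟨γ, h⟩).2
    obtain ⟨P, h1, h2, h3, h4⟩ := exists_isStarProjection_isTwistedOff
      (TopologicalSpace.denseSeq H) (A := A ∘ φ) (fun n => hA _) (fun n => hAc _)
      fun m n hmn => hAA _ _ (φ.injective.ne hmn)
    have h3' : ∀ i, IsCompactOperator (A i * P : H →L[ℂ] H) ∧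
        IsCompactOperator (P * A i : H →L[ℂ] H) := fun i => by
      simpa using h3 (φ.symm i)
    refine ⟨P, h1, h2, fun n => h3' (.inl n), fun β => h3' (.inr β), fun n => ?_⟩
    refine Set.Finite.of_finite_image (f := fun β => φ.symm (.inr β))
      ((Set.finite_Iio n).subset ?_) (φ.symm.injective.comp Sum.inr_injective).injOn
    rintro _ ⟨β, hβ, rfl⟩
    by_contra hle
    obtain ⟨u, v, hu, hv, hF, h⟩ := h4 (φ.symm (.inr β))
    simp only [Function.comp_apply, Equiv.apply_symm_apply] at h
    exact hβ ⟨u, v, hu, hv, fun g hg =>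
      hF g (Set.image_mono (Set.Iic_subset_Iic.2 (not_lt.1 hle)) hg), h⟩)
  have hPP : ∀ α β, α ≠ β → IsCompactOperator (P α * P β : H →L[ℂ] H) := fun α β hne => by
    rcases hne.lt_or_gt with h | h
    · exact ((hP β).2.2.2.1 ⟨α, h⟩).1
    · exact ((hP α).2.2.2.1 ⟨β, h⟩).2
  refine ⟨P, fun α => ⟨(hP α).1.isSelfAdjoint, (hP α).1.isIdempotentElem⟩, fun α => (hP α).2.1,
    hPP, fun α β hne h => (hP α).2.1 ?_, ?_⟩
  · have hsum : P α = (P α - P β) * P α + P β * P α := by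
      rw [sub_mul, (hP α).1.isIdempotentElem.eq, sub_add_cancel]
    rw [hsum]
    exact (h.comp_clm (P α)).add (hPP β α hne.symm)
  · rintro S hS ⟨Q, hQ, hcomm, hQP⟩
    have hd := TopologicalSpace.denseRange_denseSeq H
    set d := TopologicalSpace.denseSeq H
    have hn : ∀ α ∈ S, ∃ n, ∀ x, (∀ g ∈ d '' Set.Iic n, inner ℂ g x = 0) →
        ‖(Q α - P α) x‖ ≤ 1 / 20 * ‖x‖ := fun α hα => by
      obtain ⟨G, hGd, hG, h⟩ := exists_finite_orthogonal_norm_le (K := Q α - P α) (by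
        rw [star_sub, (hQ α hα).1.star_eq, (hP α).1.isSelfAdjoint.star_eq]
        exact hQP α hα) hd (ε := 1 / 20) (by norm_num)
      have hGd' : ∀ g ∈ G, ∃ k, d k = g := hGd
      choose! k hk using hGd'
      obtain ⟨n, hkn⟩ := (hG.image k).bddAbove
      exact ⟨n, fun x hx => h x fun g hg => hx g ⟨k g, hkn ⟨g, hg, rfl⟩, hk g hg⟩⟩
    obtain ⟨n, hSn⟩ : ∃ n, ¬ {α ∈ S | ∀ x, (∀ g ∈ d '' Set.Iic n, inner ℂ g x = 0) →
        ‖(Q α - P α) x‖ ≤ 1 / 20 * ‖x‖}.Countable := by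
      by_contra! hcon
      refine hS ((Set.countable_iUnion hcon).mono fun α hα => ?_)
      obtain ⟨n, hn⟩ := hn α hα
      exact Set.mem_iUnion.2 ⟨n, hα, hn⟩
    obtain ⟨α, ⟨hα, hαn⟩, hinf⟩ := exists_infinite_inter_Iio_of_not_countable hSn
    obtain ⟨β, ⟨⟨hβ, hβn⟩, hlt⟩, hβt⟩ := hinf.exists_notMem_finite
      (((hP α).2.2.2.2 n).image Subtype.val)
    have htw : IsTwistedOff (d '' Set.Iic n) (P α) (P β) := by
      by_contra h
      exact hβt ⟨⟨β, hlt⟩, h, rfl⟩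
    exact htw.not_commute (hP α).1 ⟨(hQ α hα).2, (hQ α hα).1⟩ ⟨(hQ β hβ).2, (hQ β hβ).1⟩
      hαn hβn (hcomm α hα β hβ)
end
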